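/- arXiv:1703.08980 — 2 statements merged into one kernel-verified Lean document; each statement's English description precedes it below -/
import Mathlib

section
/- Let ℓ ≥ 2, d, e ≥ 2, r = de, and m ∈ ℕ, and write m = be + s with b, s ∈ ℕ and 0 ≤ s < e. The multi-arrangement (A, μ) in ℂ^ℓ with defining polynomial Q(A,μ) = x_1^{dm+1} ⋯ x_ℓ^{dm+1} · ∏_{1≤i<j≤ℓ} (x_i^r − x_j^r)^{2m+1} (this is (A(G(r,e,ℓ)), mω+1)) is free with exponents exp(A,μ) = { (m−b)(ℓ−1)r + ℓdm + 1 } ∪ { (m(ℓ−1) + b + j)·r + 1 : j = 1, …, ℓ−1 }. -/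
open MvPolynomial

noncomputable section

abbrev PolyS (ℓ : ℕ) := MvPolynomial (Fin ℓ) ℂ

/-- Membership in `D(A, μ)` for the multi-arrangement in `ℂ^ℓ` consisting of the
coordinate hyperplanes `ker x_i` with multiplicity `mult0 i` and the hyperplanes
`ker (x_i - ζ x_j)` (for `i < j` and `ζ` an `r`-th root of unity) with
multiplicity `multH`.  (A multiplicity `0` means the hyperplane is absent.) -/
def InDeriv {ℓ : ℕ} (r : ℕ) (mult0 : Fin ℓ → ℕ) (multH : ℕ)
    (θ : Derivation ℂ (PolyS ℓ) (PolyS ℓ)) : Prop :=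
  (∀ i, θ (X i) ∈ Ideal.span {(X i : PolyS ℓ) ^ mult0 i}) ∧
  ∀ i j : Fin ℓ, i < j → ∀ ζ : ℂ, ζ ^ r = 1 →
    θ (X i - C ζ * X j) ∈ Ideal.span {(X i - C ζ * X j : PolyS ℓ) ^ multH}

/-- `θ` is homogeneous of polynomial degree `p`. -/
def IsHomogDeriv {ℓ : ℕ} (θ : Derivation ℂ (PolyS ℓ) (PolyS ℓ)) (p : ℕ) : Prop :=
  ∀ i, (θ (X i)).IsHomogeneous p

/-- The multi-arrangement with derivation-module membership predicate `P` is free with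
exponents `e 0, …, e (ℓ-1)`: there is a basis of the module of derivations consisting
of `ℓ` homogeneous derivations of polynomial degrees `e 0, …, e (ℓ-1)`. -/
def IsFreeWithExponents {ℓ : ℕ} (P : Derivation ℂ (PolyS ℓ) (PolyS ℓ) → Prop)
    (e : Fin ℓ → ℕ) : Prop :=
  ∃ θ : Fin ℓ → Derivation ℂ (PolyS ℓ) (PolyS ℓ),
    (∀ i, P (θ i)) ∧
    LinearIndependent (PolyS ℓ) θ ∧
    (∀ η, P η → η ∈ Submodule.span (PolyS ℓ) (Set.range θ)) ∧
    (∀ i, IsHomogDeriv (θ i) (e i))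

/-- Variant of `IsFreeWithExponents` with the exponents given as integers. -/
def IsFreeWithExponentsZ {ℓ : ℕ} (P : Derivation ℂ (PolyS ℓ) (PolyS ℓ) → Prop)
    (e : Fin ℓ → ℤ) : Prop :=
  ∃ θ : Fin ℓ → Derivation ℂ (PolyS ℓ) (PolyS ℓ),
    (∀ i, P (θ i)) ∧
    LinearIndependent (PolyS ℓ) θ ∧
    (∀ η, P η → η ∈ Submodule.span (PolyS ℓ) (Set.range θ)) ∧
    (∀ i, ∃ p : ℕ, (p : ℤ) = e i ∧ IsHomogDeriv (θ i) p)

section Univariate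

variable {R : Type*} [CommRing R]

theorem dvd_eval_one_sub_eval_zero [Algebra ℚ R] {c : R} {p : Polynomial R}
    (h : Polynomial.C c ∣ Polynomial.derivative p) : c ∣ p.eval 1 - p.eval 0 := by
  have key : Polynomial.C c ∣ p - Polynomial.C (p.coeff 0) := by
    rw [Polynomial.C_dvd_iff_dvd_coeff]
    rintro (_ | n)
    · simp
    · have h1 := (Polynomial.C_dvd_iff_dvd_coeff _ _).1 h n
      rw [Polynomial.coeff_derivative] at h1
      have h2 := h1.mul_right (algebraMap ℚ R ((n + 1 : ℚ)⁻¹))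
      have h3 : ((n : R) + 1) * algebraMap ℚ R ((n + 1 : ℚ)⁻¹) = 1 := by
        have : ((n : R) + 1) = algebraMap ℚ R (n + 1) := by simp
        rw [this, ← map_mul, mul_inv_cancel₀ (by positivity), map_one]
      rw [mul_assoc, h3, mul_one] at h2
      simpa [Polynomial.coeff_C] using h2
  have := Polynomial.eval_dvd (x := 1) key
  simpa [Polynomial.coeff_zero_eq_eval_zero] using this

/-- Algebraic form of `p b - p a = ∫_a^b p'` when `p'` vanishes to order `m` at both ends. -/
theorem pow_dvd_eval_sub_eval [Algebra ℚ R] {p : Polynomial R} {a b : R} {m : ℕ}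
    (h : ((Polynomial.X - Polynomial.C a) * (Polynomial.X - Polynomial.C b)) ^ m ∣
      Polynomial.derivative p) :
    (b - a) ^ (2 * m + 1) ∣ p.eval b - p.eval a := by
  obtain ⟨q, hq⟩ := h
  have := dvd_eval_one_sub_eval_zero (c := (b - a) ^ (2 * m + 1))
    (p := p.comp (Polynomial.C a + Polynomial.C (b - a) * Polynomial.X)) (by
      refine ⟨(Polynomial.X * (Polynomial.X - 1)) ^ m *
        q.comp (Polynomial.C a + Polynomial.C (b - a) * Polynomial.X), ?_⟩
      rw [Polynomial.derivative_comp, hq]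
      simp only [Polynomial.derivative_add, Polynomial.derivative_C, Polynomial.derivative_mul,
        Polynomial.derivative_X, Polynomial.mul_comp, Polynomial.pow_comp, Polynomial.sub_comp,
        Polynomial.X_comp, Polynomial.C_comp, map_pow, map_sub]
      have e : (Polynomial.C a + (Polynomial.C b - Polynomial.C a) * Polynomial.X - Polynomial.C a) *
          (Polynomial.C a + (Polynomial.C b - Polynomial.C a) * Polynomial.X - Polynomial.C b) =
          (Polynomial.C b - Polynomial.C a) ^ 2 * (Polynomial.X * (Polynomial.X - 1)) := by ring
      rw [e, mul_pow, ← pow_mul, pow_succ]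
      ring)
  simpa [Polynomial.eval_comp] using this

/-- The analogue of `pow_dvd_eval_sub_eval` for the Laurent polynomial `X⁻ᴺ p`, with denominators
cleared. -/
theorem pow_dvd_mul_eval_sub_mul_eval [Algebra ℚ R] {p : Polynomial R} {a b : R} {m N : ℕ}
    (h : ((Polynomial.X - Polynomial.C a) * (Polynomial.X - Polynomial.C b)) ^ m ∣
      Polynomial.X * Polynomial.derivative p - (N : Polynomial R) * p) :
    (b - a) ^ (2 * m + 1) ∣
      (a * b) ^ ((m + 1) * (N + 2)) * (a ^ N * p.eval b - b ^ N * p.eval a) := by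
  set g := (Polynomial.X - Polynomial.C a) * (Polynomial.X - Polynomial.C b) with hg
  set c := (a * b) ^ (m + 1) with hc
  obtain ⟨w, hw⟩ : Polynomial.X ∣ Polynomial.C c - g ^ (m + 1) := by
    rw [Polynomial.X_dvd_iff, Polynomial.coeff_zero_eq_eval_zero]
    simp [hg, hc]
  have ea : c = a * w.eval a := by simpa [hg] using congrArg (Polynomial.eval a) hw
  have eb : c = b * w.eval b := by simpa [hg] using congrArg (Polynomial.eval b) hw
  clear_value g c
  have hd : w + Polynomial.X * Polynomial.derivative w
      = -(((m : Polynomial R) + 1) * g ^ m * Polynomial.derivative g) := by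
    have := congrArg Polynomial.derivative hw
    simp only [Polynomial.derivative_sub, Polynomial.derivative_C, Polynomial.derivative_mul,
      Polynomial.derivative_X, Polynomial.derivative_pow_succ] at this
    simp only [Polynomial.C_add, Polynomial.C_1, Polynomial.C_eq_natCast] at this
    linear_combination -this
  have hdw : g ^ m ∣ Polynomial.C c ^ 2 * Polynomial.derivative w + Polynomial.C c * w ^ 2 := by
    refine ⟨g * (Polynomial.C c * Polynomial.derivative w + w ^ 2) -
      w * (Polynomial.C c * (m + 1) * Polynomial.derivative g + w * g), ?_⟩
    rw [pow_succ] at hw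
    linear_combination Polynomial.C c * Polynomial.derivative w * hw +
      Polynomial.C c * w * hd
  obtain ⟨q, hq⟩ := h
  obtain ⟨v, hv⟩ := hdw
  have hN : (N : Polynomial R) * w ^ (N - 1) * w = N * w ^ N := by
    cases N with
    | zero => simp
    | succ n => simp [pow_succ]; ring
  have key := pow_dvd_eval_sub_eval (p := Polynomial.C c ^ 2 * w ^ N * p) (a := a) (b := b) (m := m)
    (by
      refine ⟨(N : Polynomial R) * w ^ (N - 1) * p * v + Polynomial.C c * w ^ N * (w * q +
        g * Polynomial.derivative p), ?_⟩
      rw [← hg, ← Polynomial.C_pow, mul_assoc, Polynomial.derivative_C_mul,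
        Polynomial.derivative_mul, Polynomial.derivative_pow, Polynomial.C_pow,
        Polynomial.C_eq_natCast]
      rw [pow_succ] at hw
      linear_combination ((N : Polynomial R) * w ^ (N - 1) * p) * hv + Polynomial.C c * w ^ (N + 1) * hq -
        Polynomial.C c * p * w * hN + Polynomial.C c * w ^ N * Polynomial.derivative p * hw)
  refine (key.mul_right ((a * b) ^ N)).trans (dvd_of_eq ?_)
  simp only [Polynomial.eval_mul, Polynomial.eval_pow, Polynomial.eval_C]
  rw [pow_mul, ← hc, pow_add]
  have ea' := congrArg (· ^ N) ea
  have eb' := congrArg (· ^ N) eb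
  simp only [mul_pow] at ea' eb' ⊢
  linear_combination c ^ 2 * b ^ N * p.eval a * ea' - c ^ 2 * a ^ N * p.eval b * eb'

end Univariate

section ScaleCoeffs

variable {R : Type*} [CommRing R] [Algebra ℂ R]

/-- Multiply the `n`-th coefficient of a polynomial by `w n`. -/
def scaleCoeffs (w : ℕ → ℂ) : Polynomial R →ₗ[R] Polynomial R :=
  Polynomial.lsum fun n => algebraMap ℂ R (w n) • Polynomial.monomial n

theorem coeff_scaleCoeffs (w : ℕ → ℂ) (p : Polynomial R) (n : ℕ) :
    (scaleCoeffs w p).coeff n = algebraMap ℂ R (w n) * p.coeff n := by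
  induction p using Polynomial.induction_on' with
  | add p q hp hq => simp only [map_add, Polynomial.coeff_add, hp, hq, mul_add]
  | monomial k a =>
    simp only [scaleCoeffs, Polynomial.lsum_apply]
    rw [Polynomial.sum_monomial_index _ _ (by simp)]
    simp only [LinearMap.smul_apply, Polynomial.coeff_smul, Polynomial.coeff_monomial, smul_eq_mul]
    split_ifs with h <;> simp [h]

theorem scaleCoeffs_comp_C_mul_X (w : ℕ → ℂ) (p : Polynomial R) (y : R) :
    scaleCoeffs w (p.comp (Polynomial.C y * Polynomial.X)) =
      (scaleCoeffs w p).comp (Polynomial.C y * Polynomial.X) := by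
  ext n
  simp only [coeff_scaleCoeffs, Polynomial.comp_C_mul_X_coeff, mul_assoc]

theorem eval_scaleCoeffs (w : ℕ → ℂ) (p : Polynomial R) (y : R) :
    (scaleCoeffs w p).eval y =
      (scaleCoeffs w (p.comp (Polynomial.C y * Polynomial.X))).eval 1 := by
  rw [scaleCoeffs_comp_C_mul_X]
  simp [Polynomial.eval_comp]

/-- The weight `1 / (r (k - m) + 1)`. -/
def primWeight (r m k : ℕ) : ℂ := ((r : ℂ) * ((k : ℂ) - m) + 1)⁻¹

theorem primWeight_den_ne_zero {r : ℕ} (hr : 2 ≤ r) (m k : ℕ) :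
    (r : ℂ) * ((k : ℂ) - m) + 1 ≠ 0 := by
  intro h
  have h' : (r : ℤ) * ((k : ℤ) - m) + 1 = 0 := by exact_mod_cast h
  have : (r : ℤ) ∣ 1 := ⟨-((k : ℤ) - m), by linarith⟩
  have := Int.le_of_dvd one_pos this
  omega

theorem scaleCoeffs_primWeight_ode {r : ℕ} (hr : 2 ≤ r) (m : ℕ) (p : Polynomial R) :
    (r : Polynomial R) * (Polynomial.X * Polynomial.derivative (scaleCoeffs (primWeight r m) p) -
      (m : Polynomial R) * scaleCoeffs (primWeight r m) p) + scaleCoeffs (primWeight r m) p = p := by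
  have hX : ∀ (q : Polynomial R) (n : ℕ),
      (Polynomial.X * Polynomial.derivative q).coeff n = n * q.coeff n := by
    rintro q (_ | n)
    · simp
    · rw [Polynomial.coeff_X_mul, Polynomial.coeff_derivative]
      push_cast; ring
  ext n
  rw [Polynomial.coeff_add, ← Polynomial.C_eq_natCast, ← Polynomial.C_eq_natCast,
    Polynomial.coeff_C_mul, Polynomial.coeff_sub, Polynomial.coeff_C_mul, hX, coeff_scaleCoeffs]
  have h1 : algebraMap ℂ R ((r : ℂ) * ((n : ℂ) - m) + 1) * algebraMap ℂ R (primWeight r m n)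
      = 1 := by
    rw [← map_mul, primWeight, mul_inv_cancel₀ (primWeight_den_ne_zero hr m n), map_one]
  simp only [map_add, map_mul, map_sub, map_natCast, map_one] at h1
  linear_combination p.coeff n * h1

/-- The polynomial `z H(zʳ)`, with `H` the weighted primitive of `p`, has prescribed image under
the operator `z d/dz - r m`. -/
theorem primitive_ode {r : ℕ} (hr : 2 ≤ r) (m : ℕ) (p : Polynomial R) :
    Polynomial.X * Polynomial.derivative
        (Polynomial.X * Polynomial.expand R r (scaleCoeffs (primWeight r m) p)) -
      ((r * m : ℕ) : Polynomial R) *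
        (Polynomial.X * Polynomial.expand R r (scaleCoeffs (primWeight r m) p)) =
      Polynomial.X * Polynomial.expand R r p := by
  have h := congrArg (Polynomial.expand R r) (scaleCoeffs_primWeight_ode hr m p)
  simp only [map_add, map_mul, map_sub, map_natCast, Polynomial.expand_X] at h
  rw [Polynomial.derivative_mul, Polynomial.derivative_X, Polynomial.derivative_expand]
  have hX : (Polynomial.X : Polynomial R) ^ r = Polynomial.X * Polynomial.X ^ (r - 1) := by
    rw [← pow_succ']; congr 1; omega
  rw [hX] at h
  push_cast
  linear_combination Polynomial.X * h

/-- A polynomial `p` of small degree that vanishes to order `m` at each `y i` and to order `b` at `0`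
is zero as soon as its weighted primitive vanishes at each `y i`. -/
theorem eq_zero_of_eval_scaleCoeffs_eq_zero [IsDomain R] {r : ℕ} (hr : 2 ≤ r) {m : ℕ}
    {ι : Type*} [Fintype ι] {y : ι → R} (hy : Function.Injective y) (hy0 : ∀ i, y i ≠ 0)
    {p : Polynomial R} (hp : ∀ i, (Polynomial.X - Polynomial.C (y i)) ^ m ∣ p)
    {b : ℕ} (hb : Polynomial.X ^ b ∣ p)
    (hdeg : p.natDegree < (m + 1) * Fintype.card ι + b)
    (hev : ∀ i, (scaleCoeffs (primWeight r m) p).eval (y i) = 0) : p = 0 := by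
  classical
  have : CharZero R := charZero_of_injective_algebraMap (algebraMap ℂ R).injective
  set H := scaleCoeffs (primWeight r m) p with hH
  by_cases h0 : H = 0
  · have := scaleCoeffs_primWeight_ode hr m p
    rw [← hH, h0] at this
    simpa using this.symm
  exfalso
  have hmul : ∀ i, m + 1 ≤ H.rootMultiplicity (y i) := by
    intro i
    by_contra! hlt
    set k := H.rootMultiplicity (y i) with hk
    have hkpos : 0 < k := (Polynomial.rootMultiplicity_pos h0).2 (hev i)
    have hHk : (Polynomial.X - Polynomial.C (y i)) ^ k ∣ H := Polynomial.pow_rootMultiplicity_dvd _ _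
    have hpk : (Polynomial.X - Polynomial.C (y i)) ^ k ∣ p :=
      (pow_dvd_pow _ (by omega)).trans (hp i)
    have hder : (Polynomial.X - Polynomial.C (y i)) ^ k ∣
        (r : Polynomial R) * Polynomial.X * Polynomial.derivative H := by
      have e := scaleCoeffs_primWeight_ode hr m p
      rw [← hH] at e
      have e2 : (r : Polynomial R) * Polynomial.X * Polynomial.derivative H =
          p - H * (1 - (r : Polynomial R) * (m : Polynomial R)) := by linear_combination e
      rw [e2]
      exact dvd_sub hpk (hHk.mul_right _)
    have hdH : Polynomial.derivative H ≠ 0 := by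
      intro hz
      obtain ⟨a, ha⟩ := Polynomial.natDegree_eq_zero.1 (Polynomial.derivative_eq_zero.1 hz)
      have := hev i
      rw [← ha] at this h0
      simp only [Polynomial.eval_C] at this
      simp [this] at h0
    have hrX : ¬ (Polynomial.X - Polynomial.C (y i)) ∣ (r : Polynomial R) * Polynomial.X := by
      rw [Polynomial.dvd_iff_isRoot]
      have : (r : R) ≠ 0 := by exact_mod_cast (by omega : r ≠ 0)
      simp [Polynomial.IsRoot, this, hy0 i]
    have := (Polynomial.prime_X_sub_C (y i)).pow_dvd_of_dvd_mul_left k hrX hder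
    have := (Polynomial.le_rootMultiplicity_iff hdH).2 this
    rw [Polynomial.derivative_rootMultiplicity_of_root (hev i)] at this
    omega
  have hle : (m + 1) * Fintype.card ι + b ≤ H.natDegree := by
    refine le_trans ?_ (Polynomial.card_roots' H)
    have hb' : b ≤ H.rootMultiplicity 0 := by
      rw [Polynomial.le_rootMultiplicity_iff h0, Polynomial.C_0, sub_zero, Polynomial.X_pow_dvd_iff]
      intro n hn
      rw [hH, coeff_scaleCoeffs, Polynomial.X_pow_dvd_iff.1 hb n hn, mul_zero]
    have h1 : ∑ i, Multiset.replicate (m + 1) (y i) + Multiset.replicate b 0 ≤ H.roots := by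
      rw [Multiset.le_iff_count]
      intro a
      rw [Multiset.count_add, Multiset.count_sum', Polynomial.count_roots]
      simp only [Multiset.count_replicate]
      by_cases ha : ∃ i, y i = a
      · obtain ⟨i, rfl⟩ := ha
        rw [Finset.sum_eq_single i (fun j _ hj => if_neg (fun e => hj (hy e))) (by simp),
          if_neg (hy0 i).symm]
        simpa using hmul i
      · rw [Finset.sum_eq_zero fun i _ => if_neg fun e => ha ⟨i, e⟩, zero_add]
        split_ifs with h
        · exact h ▸ hb'
        · exact Nat.zero_le _
    have := Multiset.card_le_card h1
    simpa [mul_comm] using this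
  have hHp : H.natDegree ≤ p.natDegree := by
    rw [Polynomial.natDegree_le_iff_coeff_eq_zero]
    intro N hN
    rw [hH, coeff_scaleCoeffs, Polynomial.coeff_eq_zero_of_natDegree_lt hN, mul_zero]
  omega

end ScaleCoeffs

section LinearForms

variable {ℓ : ℕ}

theorem irreducible_X_sub_C_mul_X {i k : Fin ℓ} (hik : i ≠ k) (ζ : ℂ) :
    Irreducible (X i - C ζ * X k : PolyS ℓ) := by
  have hc : coeff (Finsupp.single i 1) (X i - C ζ * X k : PolyS ℓ) = 1 := by
    rw [coeff_sub, coeff_C_mul, coeff_X, coeff_X, if_pos rfl, if_neg, mul_zero, sub_zero]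
    exact fun h => hik (Finsupp.single_left_injective one_ne_zero h).symm
  have h0 : (X i - C ζ * X k : PolyS ℓ) ≠ 0 := fun h => by simp [h] at hc
  refine irreducible_of_totalDegree_eq_one ?_ fun x hx => ?_
  · exact ((isHomogeneous_X ℂ i).sub (isHomogeneous_C_mul_X ζ k)).totalDegree h0
  · exact isUnit_of_dvd_one (hc ▸ hx (Finsupp.single i 1))

theorem isRelPrime_X_sub_C_mul_X_X {i k : Fin ℓ} (hik : i ≠ k) {ζ : ℂ} (hζ : ζ ≠ 0) (n : Fin ℓ) :
    IsRelPrime (X i - C ζ * X k : PolyS ℓ) (X n) := by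
  rw [(irreducible_X_sub_C_mul_X hik ζ).isRelPrime_iff_not_dvd]
  intro h
  have := _root_.map_dvd (eval (fun n => if n = i then ζ else if n = k then 1 else 0 : Fin ℓ → ℂ)) h
  simp only [map_sub, map_mul, eval_X, eval_C, if_true, if_neg hik.symm, mul_one, sub_self,
    zero_dvd_iff] at this
  split_ifs at this with h1 h2
  · exact hζ this
  · exact one_ne_zero this
  · have := _root_.map_dvd (eval (fun j => if j = n then 1 else 0 : Fin ℓ → ℂ)) h
    simp [Ne.symm h1, Ne.symm h2] at this

theorem isRelPrime_X_X {i k : Fin ℓ} (hik : i ≠ k) : IsRelPrime (X i : PolyS ℓ) (X k) := by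
  rw [X_prime.irreducible.isRelPrime_iff_not_dvd]
  intro h
  have := _root_.map_dvd (eval (fun j => if j = k then 1 else 0 : Fin ℓ → ℂ)) h
  simp [hik] at this

theorem isRelPrime_X_sub_C_mul_X {i k i' k' : Fin ℓ} (hik : i < k) (hik' : i' < k') {ζ ζ' : ℂ}
    (hζ : ζ' ≠ 0) (hne : ¬ (i = i' ∧ k = k' ∧ ζ = ζ')) :
    IsRelPrime (X i - C ζ * X k : PolyS ℓ) (X i' - C ζ' * X k') := by
  rw [(irreducible_X_sub_C_mul_X hik.ne ζ).isRelPrime_iff_not_dvd]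
  intro h
  have hpt : ∀ n, n ≠ i → n ≠ k → n ≠ i' ∧ n ≠ k' := by
    intro n h1 h2
    have := _root_.map_dvd (eval (fun j => if j = n then 1 else 0 : Fin ℓ → ℂ)) h
    simp only [map_sub, map_mul, eval_X, eval_C, if_neg h1.symm, if_neg h2.symm, mul_zero,
      sub_self, zero_dvd_iff] at this
    constructor
    · rintro rfl
      simp [hik'.ne'] at this
    · rintro rfl
      simp [hik'.ne, hζ] at this
  have hi : i' = i ∨ i' = k := by
    by_contra! hcon
    exact (hpt i' hcon.1 hcon.2).1 rfl
  have hk : k' = i ∨ k' = k := by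
    by_contra! hcon
    exact (hpt k' hcon.1 hcon.2).2 rfl
  obtain ⟨rfl, rfl⟩ : i' = i ∧ k' = k := by omega
  have := _root_.map_dvd
    (eval (fun n => if n = i' then ζ else if n = k' then 1 else 0 : Fin ℓ → ℂ)) h
  simp only [map_sub, map_mul, eval_X, eval_C, if_true, if_neg hik.ne', mul_one, sub_self,
    zero_dvd_iff, sub_eq_zero] at this
  exact hne ⟨rfl, rfl, this⟩

end LinearForms

section Saito

variable {ℓ : ℕ}

/-- Index set of the hyperplanes `x_i = ζ x_j` with `i < j` and `ζ ^ r = 1`. -/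
def diagIndex (ℓ r : ℕ) : Finset (Σ _ : Fin ℓ, Fin ℓ × ℂ) :=
  Finset.univ.sigma fun i => Finset.Ioi i ×ˢ Polynomial.nthRootsFinset r (1 : ℂ)

theorem mem_diagIndex {r : ℕ} (hr : 0 < r) {t : Σ _ : Fin ℓ, Fin ℓ × ℂ} :
    t ∈ diagIndex ℓ r ↔ t.1 < t.2.1 ∧ t.2.2 ^ r = 1 := by
  simp [diagIndex, Polynomial.mem_nthRootsFinset hr]

theorem two_mul_card_diagIndex {r : ℕ} (hr : 0 < r) :
    2 * (diagIndex ℓ r).card = r * (ℓ * (ℓ - 1)) := by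
  have hroots : (Polynomial.nthRootsFinset r (1 : ℂ)).card = r :=
    (Complex.isPrimitiveRoot_exp r hr.ne').card_nthRootsFinset
  rw [diagIndex, Finset.card_sigma]
  simp only [Finset.card_product, hroots, Fin.card_Ioi]
  rw [← Finset.sum_mul, Fin.sum_univ_eq_sum_range (fun i => ℓ - 1 - i) ℓ,
    Finset.sum_range_reflect (fun i => i) ℓ]
  have := Finset.sum_range_id_mul_two ℓ
  linear_combination r * this

/-- The defining polynomial of the multi-arrangement. -/
def defPoly (ℓ r a c : ℕ) : PolyS ℓ :=
  (∏ i, X i ^ a) * ∏ t ∈ diagIndex ℓ r, (X t.1 - C t.2.2 * X t.2.1) ^ c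

theorem isHomogeneous_defPoly (ℓ r a c : ℕ) :
    (defPoly ℓ r a c).IsHomogeneous (ℓ * a + (diagIndex ℓ r).card * c) := by
  refine IsHomogeneous.mul ?_ ?_
  · have := IsHomogeneous.prod Finset.univ (fun i : Fin ℓ => (X i : PolyS ℓ) ^ a) (fun _ => a)
      fun i _ => isHomogeneous_X_pow i a
    simpa using this
  · have := IsHomogeneous.prod (diagIndex ℓ r)
      (fun t => (X t.1 - C t.2.2 * X t.2.1 : PolyS ℓ) ^ c) (fun _ => c) fun t _ => by
        simpa using ((isHomogeneous_X ℂ t.1).sub (isHomogeneous_C_mul_X t.2.2 t.2.1)).pow c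
    simpa using this

theorem defPoly_dvd {r : ℕ} (hr : 0 < r) {a c : ℕ} {p : PolyS ℓ} (h0 : ∀ i, X i ^ a ∣ p)
    (h1 : ∀ i j : Fin ℓ, i < j → ∀ ζ : ℂ, ζ ^ r = 1 → (X i - C ζ * X j) ^ c ∣ p) :
    defPoly ℓ r a c ∣ p := by
  have hz : ∀ {ζ : ℂ}, ζ ^ r = 1 → ζ ≠ 0 := by
    rintro ζ h rfl
    simp [hr.ne'] at h
  refine IsRelPrime.mul_dvd ?_ ?_ ?_
  · refine IsRelPrime.prod_left fun i _ => IsRelPrime.prod_right fun t ht => ?_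
    obtain ⟨h, hζ⟩ := (mem_diagIndex hr).1 ht
    exact ((isRelPrime_X_sub_C_mul_X_X h.ne (hz hζ) i).symm).pow
  · exact Finset.prod_dvd_of_isRelPrime (fun i _ j _ hij => (isRelPrime_X_X hij).pow)
      fun i _ => h0 i
  · refine Finset.prod_dvd_of_isRelPrime (fun t ht t' ht' hne => ?_) fun t ht => ?_
    · obtain ⟨h, hζ⟩ := (mem_diagIndex hr).1 ht
      obtain ⟨h', hζ'⟩ := (mem_diagIndex hr).1 ht'
      refine (isRelPrime_X_sub_C_mul_X h h' (hz hζ') fun he => hne ?_).pow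
      rcases t with ⟨i, k, ζ⟩
      rcases t' with ⟨i', k', ζ'⟩
      simp only at he
      obtain ⟨rfl, rfl, rfl⟩ := he
      rfl
    · obtain ⟨h, hζ⟩ := (mem_diagIndex hr).1 ht
      exact h1 _ _ h _ hζ

theorem dvd_det_of_dvd_col {n R : Type*} [Fintype n] [DecidableEq n] [CommRing R]
    {M : Matrix n n R} {c : R} (i : n) (h : ∀ j, c ∣ M j i) : c ∣ M.det := by
  choose v hv using h
  refine ⟨(M.updateCol i v).det, ?_⟩
  rw [← Matrix.det_updateCol_smul]
  congr 1
  ext j k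
  rw [Matrix.updateCol_apply]
  split_ifs with hk
  · rw [hk, hv]; rfl
  · rfl

theorem defPoly_dvd_det {r : ℕ} (hr : 0 < r) {a c : ℕ}
    {θ : Fin ℓ → Derivation ℂ (PolyS ℓ) (PolyS ℓ)} (h : ∀ j, InDeriv r (fun _ => a) c (θ j)) :
    defPoly ℓ r a c ∣ (Matrix.of fun j i => θ j (X i)).det := by
  refine defPoly_dvd hr (fun i => ?_) fun i k hik ζ hζ => ?_
  · exact dvd_det_of_dvd_col i fun j => Ideal.mem_span_singleton.1 ((h j).1 i)
  · rw [← Matrix.det_updateCol_add_smul_self _ hik.ne (-C ζ)]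
    refine dvd_det_of_dvd_col i fun j => ?_
    have := Ideal.mem_span_singleton.1 ((h j).2 i k hik ζ hζ)
    rw [map_sub, ← smul_eq_C_mul, Derivation.map_smul, smul_eq_C_mul, smul_eq_C_mul] at this
    simpa [Matrix.updateCol_apply, sub_eq_add_neg] using this

/-- Saito's criterion. -/
theorem mem_span_of_linearIndependent {r : ℕ} (hr : 0 < r) {a c : ℕ} {e : Fin ℓ → ℕ}
    {θ : Fin ℓ → Derivation ℂ (PolyS ℓ) (PolyS ℓ)} (h : ∀ j, InDeriv r (fun _ => a) c (θ j))
    (hdet : (Matrix.of fun j i => θ j (X i)).det ≠ 0)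
    (hhom : ∀ j, IsHomogDeriv (θ j) (e j))
    (hsum : ∑ j, e j = ℓ * a + (diagIndex ℓ r).card * c)
    {η : Derivation ℂ (PolyS ℓ) (PolyS ℓ)} (hη : InDeriv r (fun _ => a) c η) :
    η ∈ Submodule.span (PolyS ℓ) (Set.range θ) := by
  set M : Matrix (Fin ℓ) (Fin ℓ) (PolyS ℓ) := Matrix.of fun j i => θ j (X i) with hM
  obtain ⟨u, hu⟩ := defPoly_dvd_det hr h
  rw [← hM] at hu
  have hQ0 : defPoly ℓ r a c ≠ 0 := fun h0 => hdet (by rw [hu, h0, zero_mul])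
  have hu0 : u ≠ 0 := fun h0 => hdet (by rw [hu, h0, mul_zero])
  have hdethom : M.det.IsHomogeneous (∑ j, e j) := by
    rw [Matrix.det_apply]
    refine IsHomogeneous.sum _ _ _ fun σ _ => ?_
    have hp : (∏ i, M (σ i) i).IsHomogeneous (∑ i, e (σ i)) :=
      IsHomogeneous.prod _ _ _ fun i _ => hhom (σ i) i
    rw [Equiv.sum_comp σ e] at hp
    rcases Int.units_eq_one_or (Equiv.Perm.sign σ) with hs | hs
    · simpa [hs] using hp
    · simpa [hs] using hp.neg
  have hudeg : u.totalDegree = 0 := by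
    have h1 := hdethom.totalDegree hdet
    rw [hu, totalDegree_mul_of_isDomain hQ0 hu0,
      (isHomogeneous_defPoly ℓ r a c).totalDegree hQ0, hsum] at h1
    omega
  obtain ⟨u', rfl⟩ : ∃ u', u = C u' := ⟨_, totalDegree_eq_zero_iff_eq_C.1 hudeg⟩
  have hu' : u' ≠ 0 := fun h0 => hu0 (by rw [h0, C_0])
  set v : Fin ℓ → PolyS ℓ := fun i => η (X i) with hv
  have hcr : ∀ j, ∃ w, M.transpose.cramer v j = defPoly ℓ r a c * w := by
    intro j
    rw [Matrix.cramer_transpose_apply]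
    have := defPoly_dvd_det hr (θ := Function.update θ j η) (a := a) (c := c) (by
      intro k
      rcases eq_or_ne k j with rfl | hk
      · simpa using hη
      · simpa [hk] using h k)
    have hM' : M.updateRow j v = Matrix.of fun k i => Function.update θ j η k (X i) := by
      refine Matrix.ext fun k i => ?_
      rcases eq_or_ne k j with rfl | hk
      · simp [hv]
      · simp [hk, hM]
    rw [hM']
    exact this
  choose w hw using hcr
  have hsol : ∀ i, v i = ∑ j, (C u'⁻¹ * w j) * θ j (X i) := by
    intro i
    have h1 := congrFun (Matrix.mulVec_cramer M.transpose v) i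
    simp only [Matrix.mulVec, dotProduct, Matrix.transpose_apply, Matrix.det_transpose,
      Pi.smul_apply, smul_eq_mul, hw, hu] at h1
    have h2 : defPoly ℓ r a c * (C u' * v i) = defPoly ℓ r a c * ∑ j, w j * θ j (X i) := by
      rw [Finset.mul_sum, ← mul_assoc, ← h1]
      exact Finset.sum_congr rfl fun j _ => by simp only [hM, Matrix.of_apply]; ring
    have h3 := mul_left_cancel₀ hQ0 h2
    simp only [mul_assoc]
    rw [← Finset.mul_sum, ← h3, ← mul_assoc, ← C_mul, inv_mul_cancel₀ hu', C_1, one_mul]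
  have hη' : η = ∑ j, (C u'⁻¹ * w j) • θ j := by
    refine derivation_ext fun i => ?_
    rw [← Derivation.coeFnAddMonoidHom_apply (∑ j, _), map_sum, Finset.sum_apply]
    exact hsol i
  rw [hη']
  exact Submodule.sum_mem _ fun j _ => Submodule.smul_mem _ _ (Submodule.subset_span ⟨j, rfl⟩)

theorem linearIndependent_of_det_ne_zero {θ : Fin ℓ → Derivation ℂ (PolyS ℓ) (PolyS ℓ)}
    (hdet : (Matrix.of fun j i => θ j (X i)).det ≠ 0) : LinearIndependent (PolyS ℓ) θ := by
  rw [Fintype.linearIndependent_iff]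
  intro f hf
  refine congrFun (Matrix.eq_zero_of_vecMul_eq_zero hdet (v := f) ?_)
  ext1 i
  have := congrArg (fun D : Derivation ℂ (PolyS ℓ) (PolyS ℓ) => D (X i)) hf
  rw [← Derivation.coeFnAddMonoidHom_apply (∑ j, _), map_sum, Finset.sum_apply] at this
  exact this

end Saito

section Construction

variable {ℓ : ℕ}

theorem coeff_mul_isHomogeneous {p q : Polynomial (PolyS ℓ)} {D E : ℕ}
    (hp : ∀ n, (p.coeff n).IsHomogeneous D) (hq : ∀ n, (q.coeff n).IsHomogeneous E) (n : ℕ) :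
    ((p * q).coeff n).IsHomogeneous (D + E) := by
  rw [Polynomial.coeff_mul]
  exact IsHomogeneous.sum _ _ _ fun x _ => (hp x.1).mul (hq x.2)

theorem coeff_one_isHomogeneous (n : ℕ) :
    ((1 : Polynomial (PolyS ℓ)).coeff n).IsHomogeneous 0 := by
  rw [Polynomial.coeff_one]
  split_ifs
  · exact isHomogeneous_one _ _
  · exact isHomogeneous_zero _ _ _

theorem coeff_prod_isHomogeneous {ι : Type*} {s : Finset ι} {p : ι → Polynomial (PolyS ℓ)} {D : ℕ}
    (hp : ∀ i ∈ s, ∀ n, ((p i).coeff n).IsHomogeneous D) (n : ℕ) :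
    ((∏ i ∈ s, p i).coeff n).IsHomogeneous (s.card * D) := by
  classical
  induction s using Finset.induction_on generalizing n with
  | empty => simpa using coeff_one_isHomogeneous n
  | insert i s hi ih =>
    rw [Finset.prod_insert hi, Finset.card_insert_of_notMem hi, add_mul, one_mul, add_comm]
    exact coeff_mul_isHomogeneous (hp i (by simp)) (ih fun j hj => hp j (by simp [hj])) n

theorem coeff_pow_isHomogeneous {p : Polynomial (PolyS ℓ)} {D : ℕ}
    (hp : ∀ n, (p.coeff n).IsHomogeneous D) (m n : ℕ) :
    ((p ^ m).coeff n).IsHomogeneous (m * D) := by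
  simpa using coeff_prod_isHomogeneous (s := Finset.range m) (p := fun _ => p) (fun _ _ => hp) n

/-- The integrand `t ^ c ∏ (t - x_k ^ r) ^ m`. -/
def integrand (ℓ r m c : ℕ) : Polynomial (PolyS ℓ) :=
  Polynomial.X ^ c * ∏ k, (Polynomial.X - Polynomial.C (X k ^ r)) ^ m

/-- What remains of `integrand ℓ r m c` after substituting `t = x_i ^ r u` and removing the factor
`x_i ^ (r (c + m))`. -/
def reducedIntegrand (r m c : ℕ) (i : Fin ℓ) : Polynomial (PolyS ℓ) :=
  Polynomial.X ^ c * (Polynomial.X - 1) ^ m * ∏ k ∈ Finset.univ.erase i,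
    (Polynomial.C (X i ^ r) * Polynomial.X - Polynomial.C (X k ^ r)) ^ m

/-- The coefficient, up to the factor `x_i`, of the `i`-th partial derivative in the derivations
of the basis. -/
def basisCoeff (r m c : ℕ) (i : Fin ℓ) : PolyS ℓ :=
  X i ^ (r * c) * (scaleCoeffs (primWeight r m) (reducedIntegrand r m c i)).eval 1

theorem integrand_comp (r m c : ℕ) (i : Fin ℓ) :
    (integrand ℓ r m c).comp (Polynomial.C (X i ^ r) * Polynomial.X) =
      (X i ^ (r * m) * X i ^ (r * c) : PolyS ℓ) • reducedIntegrand r m c i := by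
  rw [integrand, reducedIntegrand, ← Finset.mul_prod_erase _ _ (Finset.mem_univ i),
    Polynomial.smul_eq_C_mul]
  simp only [Polynomial.mul_comp, Polynomial.pow_comp, Polynomial.X_comp, Polynomial.sub_comp,
    Polynomial.C_comp, Polynomial.prod_comp, mul_pow, map_mul, map_pow, pow_mul]
  rw [show Polynomial.C (X i) ^ r * Polynomial.X - Polynomial.C (X i) ^ r =
    (Polynomial.C (X i : PolyS ℓ)) ^ r * (Polynomial.X - 1) by ring, mul_pow]
  ring

theorem eval_scaleCoeffs_integrand (r m c : ℕ) (i : Fin ℓ) :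
    (scaleCoeffs (primWeight r m) (integrand ℓ r m c)).eval (X i ^ r) =
      X i ^ (r * m) * basisCoeff r m c i := by
  rw [eval_scaleCoeffs, integrand_comp, map_smul, Polynomial.eval_smul, basisCoeff, smul_eq_mul,
    mul_assoc]

theorem basisCoeff_isHomogeneous (r m c : ℕ) (i : Fin ℓ) :
    (basisCoeff r m c i).IsHomogeneous (r * c + (ℓ - 1) * (m * r)) := by
  refine (isHomogeneous_X_pow i _).mul ?_
  have hred : ∀ n, ((reducedIntegrand r m c i).coeff n).IsHomogeneous ((ℓ - 1) * (m * r)) := by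
    intro n
    have h1 : ∀ n, ((Polynomial.X ^ c * (Polynomial.X - 1) ^ m :
        Polynomial (PolyS ℓ)).coeff n).IsHomogeneous 0 := by
      have hX : ∀ n, ((Polynomial.X : Polynomial (PolyS ℓ)).coeff n).IsHomogeneous 0 := by
        intro n
        rw [Polynomial.coeff_X]
        split_ifs
        · exact isHomogeneous_one _ _
        · exact isHomogeneous_zero _ _ _
      refine coeff_mul_isHomogeneous (D := 0) (E := 0) (coeff_pow_isHomogeneous hX c)
        (coeff_pow_isHomogeneous (D := 0) (fun n => ?_) m)
      rw [Polynomial.coeff_sub]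
      exact (hX n).sub (coeff_one_isHomogeneous n)
    have h2 := coeff_prod_isHomogeneous (s := Finset.univ.erase i)
      (p := fun k => (Polynomial.C (X i ^ r : PolyS ℓ) * Polynomial.X - Polynomial.C (X k ^ r)) ^ m)
      (D := m * r) fun k _ => coeff_pow_isHomogeneous (fun n => by
        rw [Polynomial.coeff_sub, Polynomial.coeff_C_mul, Polynomial.coeff_X, Polynomial.coeff_C]
        refine IsHomogeneous.sub ?_ ?_
        · split_ifs
          · simpa using isHomogeneous_X_pow i r
          · simpa using isHomogeneous_zero _ _ _
        · split_ifs
          · exact isHomogeneous_X_pow k r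
          · exact isHomogeneous_zero _ _ _) m
    have h3 := coeff_mul_isHomogeneous h1 h2 n
    simpa [reducedIntegrand, Finset.card_erase_of_mem] using h3
  rw [Polynomial.eval_eq_sum_range]
  refine IsHomogeneous.sum _ _ _ fun n _ => ?_
  rw [one_pow, mul_one, coeff_scaleCoeffs]
  exact (hred n).C_mul _

theorem pow_dvd_basisCoeff_sub {r : ℕ} (hr : 2 ≤ r) (m c : ℕ) {i k : Fin ℓ} (hik : i ≠ k) {ζ : ℂ}
    (hζ : ζ ^ r = 1) :
    (X i - C ζ * X k) ^ (2 * m + 1) ∣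
      X i * basisCoeff r m c i - C ζ * (X k * basisCoeff r m c k) := by
  have hζ0 : ζ ≠ 0 := by
    rintro rfl
    rw [zero_pow (by omega)] at hζ
    exact zero_ne_one hζ
  have hζr : (C ζ * X k : PolyS ℓ) ^ r = X k ^ r := by rw [mul_pow, ← C_pow, hζ, C_1, one_mul]
  have hroot : ∀ (a : PolyS ℓ) (n : Fin ℓ), a ^ r = X n ^ r →
      (Polynomial.X - Polynomial.C a) ∣
        (Polynomial.X ^ r - Polynomial.C (X n ^ r) : Polynomial (PolyS ℓ)) := by
    intro a n ha
    rw [Polynomial.dvd_iff_isRoot]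
    simp [Polynomial.IsRoot, ha]
  obtain ⟨q, hq⟩ : ∃ q, integrand ℓ r m c = (Polynomial.X - Polynomial.C (X i ^ r)) ^ m *
      ((Polynomial.X - Polynomial.C (X k ^ r)) ^ m * q) := by
    rw [integrand, ← Finset.mul_prod_erase _ _ (Finset.mem_univ i),
      ← Finset.mul_prod_erase _ _ (Finset.mem_erase.2 ⟨hik.symm, Finset.mem_univ k⟩)]
    exact ⟨Polynomial.X ^ c * ∏ n ∈ (Finset.univ.erase i).erase k,
      (Polynomial.X - Polynomial.C (X n ^ r)) ^ m, by ring⟩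
  have hexp : Polynomial.expand (PolyS ℓ) r (integrand ℓ r m c) =
      (Polynomial.X ^ r - Polynomial.C (X i ^ r)) ^ m *
        ((Polynomial.X ^ r - Polynomial.C (X k ^ r)) ^ m * Polynomial.expand (PolyS ℓ) r q) := by
    rw [hq]
    simp
  have h := pow_dvd_mul_eval_sub_mul_eval (R := PolyS ℓ) (m := m) (N := r * m)
    (a := C ζ * X k) (b := X i)
    (p := Polynomial.X * Polynomial.expand (PolyS ℓ) r
      (scaleCoeffs (primWeight r m) (integrand ℓ r m c))) (by
      rw [primitive_ode hr, hexp, mul_pow]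
      refine Dvd.dvd.mul_left ?_ _
      rw [mul_comm]
      exact mul_dvd_mul (pow_dvd_pow_of_dvd (hroot _ i rfl) m)
        ((pow_dvd_pow_of_dvd (hroot _ k hζr) m).mul_right _))
  simp only [Polynomial.eval_mul, Polynomial.eval_X, Polynomial.expand_eval, hζr,
    eval_scaleCoeffs_integrand] at h
  have hpow : (C ζ * X k : PolyS ℓ) ^ (r * m) = X k ^ (r * m) := by rw [pow_mul, hζr, ← pow_mul]
  rw [hpow] at h
  set B := (m + 1) * (r * m + 2)
  have h' : (X i - C ζ * X k) ^ (2 * m + 1) ∣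
      ((C ζ ^ B) * (X k ^ B * X i ^ B * X k ^ (r * m) * X i ^ (r * m))) *
      (X i * basisCoeff r m c i - C ζ * (X k * basisCoeff r m c k)) := by
    convert h using 1
    ring
  refine IsRelPrime.dvd_of_dvd_mul_left ?_ h'
  have hX : ∀ n, IsRelPrime (X i - C ζ * X k : PolyS ℓ) (X n) :=
    isRelPrime_X_sub_C_mul_X_X hik hζ0
  refine IsRelPrime.pow_left ?_
  refine IsRelPrime.mul_right ?_ (((hX k).pow_right.mul_right (hX i).pow_right).mul_right
    (hX k).pow_right |>.mul_right (hX i).pow_right)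
  exact IsUnit.isRelPrime_right (((isUnit_iff_ne_zero.2 hζ0).map C).pow B)

/-- The members of the basis: `(x_1 ⋯ x_ℓ) ^ N ∑ x_i (basisCoeff r m c i) ∂_i`. -/
def basisDeriv (r m c N : ℕ) : Derivation ℂ (PolyS ℓ) (PolyS ℓ) :=
  mkDerivation ℂ fun i => (∏ k, X k) ^ N * (X i * basisCoeff r m c i)

theorem basisDeriv_X (r m c N : ℕ) (i : Fin ℓ) :
    basisDeriv r m c N (X i) = (∏ k, X k) ^ N * (X i * basisCoeff r m c i) :=
  mkDerivation_X _ _ _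

theorem basisDeriv_isHomogDeriv (r m c N : ℕ) :
    IsHomogDeriv (basisDeriv r m c N : Derivation ℂ (PolyS ℓ) (PolyS ℓ))
      (ℓ * N + (1 + (r * c + (ℓ - 1) * (m * r)))) := by
  intro i
  rw [basisDeriv_X]
  refine IsHomogeneous.mul ?_ ((isHomogeneous_X _ i).mul (basisCoeff_isHomogeneous r m c i))
  have := (IsHomogeneous.prod Finset.univ (fun k : Fin ℓ => (X k : PolyS ℓ)) (fun _ => 1)
    fun k _ => isHomogeneous_X ℂ k).pow N
  simpa using this

theorem basisDeriv_inDeriv {r : ℕ} (hr : 2 ≤ r) {m c N a : ℕ} (ha : a ≤ N + r * c) :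
    InDeriv r (fun _ => a + 1) (2 * m + 1)
      (basisDeriv r m c N : Derivation ℂ (PolyS ℓ) (PolyS ℓ)) := by
  refine ⟨fun i => Ideal.mem_span_singleton.2 ?_, fun i k hik ζ hζ => Ideal.mem_span_singleton.2 ?_⟩
  · rw [basisDeriv_X, basisCoeff]
    refine (pow_dvd_pow (X i : PolyS ℓ) (show a + 1 ≤ N + (1 + r * c) by omega)).trans ?_
    rw [pow_add, pow_add, pow_one, ← mul_assoc (X i)]
    exact mul_dvd_mul (pow_dvd_pow_of_dvd (Finset.dvd_prod_of_mem _ (Finset.mem_univ i)) N)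
      (dvd_mul_right _ _)
  · rw [map_sub, ← smul_eq_C_mul, Derivation.map_smul, smul_eq_C_mul, smul_eq_C_mul, basisDeriv_X,
      basisDeriv_X]
    refine ((pow_dvd_basisCoeff_sub hr m c hik.ne hζ).mul_left ((∏ k, X k) ^ N)).trans
      (dvd_of_eq ?_)
    ring

theorem natDegree_integrand_le (r m c : ℕ) : (integrand ℓ r m c).natDegree ≤ c + ℓ * m := by
  refine Polynomial.natDegree_mul_le.trans (add_le_add (Polynomial.natDegree_X_pow_le c) ?_)
  refine (Polynomial.natDegree_prod_le _ _).trans ?_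
  simp only [Polynomial.natDegree_pow, Polynomial.natDegree_X_sub_C]
  simp

theorem X_pow_injective {r : ℕ} (hr : r ≠ 0) :
    Function.Injective fun i : Fin ℓ => (X i : PolyS ℓ) ^ r := by
  intro i k hik
  by_contra hne
  have h : (X i : PolyS ℓ) ∣ X k := X_prime.dvd_of_dvd_pow ((dvd_pow_self _ hr).trans hik.dvd)
  exact X_prime.irreducible.isRelPrime_iff_not_dvd.1 (isRelPrime_X_X hne) h

theorem det_basisDeriv_ne_zero {r : ℕ} (hr : 2 ≤ r) (m b : ℕ) (N : Fin ℓ → ℕ) :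
    (Matrix.of fun j i : Fin ℓ => basisDeriv (ℓ := ℓ) r m (b + (j : ℕ)) (N j) (X i)).det ≠ 0 := by
  intro hdet
  obtain ⟨v, hv0, hv⟩ := Matrix.exists_vecMul_eq_zero_iff.2 hdet
  set f : Fin ℓ → PolyS ℓ := fun j => v j * (∏ k, X k) ^ N j with hf
  have hp : ∑ j, f j • integrand ℓ r m (b + (j : ℕ)) =
      (∑ j, f j • Polynomial.X ^ (j : ℕ)) * integrand ℓ r m b := by
    rw [Finset.sum_mul]
    refine Finset.sum_congr rfl fun j _ => ?_
    rw [integrand, integrand, pow_add, Polynomial.smul_eq_C_mul, Polynomial.smul_eq_C_mul]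
    ring
  have hℓ : 0 < ℓ := by
    rcases Nat.eq_zero_or_pos ℓ with rfl | h
    · exact absurd (Subsingleton.elim v 0) hv0
    · exact h
  have hdvd : ∀ i : Fin ℓ, (Polynomial.X - Polynomial.C (X i ^ r : PolyS ℓ)) ^ m ∣
      integrand ℓ r m b := fun i => dvd_mul_of_dvd_right (Finset.dvd_prod_of_mem (fun k : Fin ℓ =>
        (Polynomial.X - Polynomial.C (X k ^ r : PolyS ℓ)) ^ m) (Finset.mem_univ i)) _
  have hdeg : (∑ j, f j • integrand ℓ r m (b + (j : ℕ))).natDegree <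
      (m + 1) * Fintype.card (Fin ℓ) + b := by
    have hle : (∑ j, f j • integrand ℓ r m (b + (j : ℕ))).natDegree ≤ b + (ℓ - 1) + ℓ * m := by
      refine Polynomial.natDegree_sum_le_of_forall_le _ _ fun j _ => ?_
      refine (Polynomial.natDegree_smul_le _ _).trans ((natDegree_integrand_le _ _ _).trans ?_)
      have := j.2
      omega
    rw [Fintype.card_fin, add_mul, one_mul, mul_comm m]
    omega
  have hev : ∀ i : Fin ℓ, (scaleCoeffs (primWeight r m)
      (∑ j, f j • integrand ℓ r m (b + (j : ℕ)))).eval (X i ^ r) = 0 := by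
    intro i
    have h1 := congrFun hv i
    simp only [Matrix.vecMul, dotProduct, Matrix.of_apply, basisDeriv_X, Pi.zero_apply] at h1
    have h2 : X i * ∑ j, f j * basisCoeff r m (b + (j : ℕ)) i = 0 := by
      rw [Finset.mul_sum, ← h1]
      exact Finset.sum_congr rfl fun j _ => by rw [hf]; ring
    have h3 := (mul_eq_zero.1 h2).resolve_left (X_ne_zero i)
    simp only [map_sum, map_smul, Polynomial.eval_finsetSum, Polynomial.eval_smul, smul_eq_mul,
      eval_scaleCoeffs_integrand]
    rw [← mul_zero (X i ^ (r * m)), ← h3, Finset.mul_sum]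
    exact Finset.sum_congr rfl fun j _ => by ring
  have hzero := eq_zero_of_eval_scaleCoeffs_eq_zero hr (m := m) (b := b)
    (y := fun i : Fin ℓ => (X i : PolyS ℓ) ^ r) (X_pow_injective (Nat.ne_zero_of_lt hr))
    (fun i => pow_ne_zero _ (X_ne_zero i)) (fun i => hp ▸ dvd_mul_of_dvd_right (hdvd i) _)
    (hp ▸ dvd_mul_of_dvd_right (dvd_mul_right _ _) _) hdeg hev
  have hint : integrand ℓ r m b ≠ 0 :=
    mul_ne_zero (pow_ne_zero _ Polynomial.X_ne_zero)
      (Finset.prod_ne_zero_iff.2 fun k _ => pow_ne_zero _ (Polynomial.X_sub_C_ne_zero _))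
  have hsum := (mul_eq_zero.1 (hp ▸ hzero)).resolve_right hint
  refine hv0 (funext fun j => ?_)
  have hj := congrArg (fun q => Polynomial.coeff q (j : ℕ)) hsum
  simp only [Polynomial.finsetSum_coeff, Polynomial.coeff_smul, Polynomial.coeff_X_pow,
    smul_eq_mul, mul_ite, mul_one, mul_zero, Polynomial.coeff_zero] at hj
  rw [Finset.sum_eq_single j (fun k _ hk => if_neg fun h => hk (Fin.ext h.symm)) (by simp),
    if_pos rfl] at hj
  exact (mul_eq_zero.1 hj).resolve_right
    (pow_ne_zero _ (Finset.prod_ne_zero_iff.2 fun k _ => X_ne_zero k))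

end Construction

theorem stmt4 (ℓ d e : ℕ) (hℓ : 2 ≤ ℓ) (hd : 2 ≤ d) (he : 2 ≤ e)
    (m b s : ℕ) (hm : m = b * e + s) (hs : s < e) :
    IsFreeWithExponents
      (InDeriv (d * e) (fun _ : Fin ℓ => d * m + 1) (2 * m + 1))
      (fun i => if (i : ℕ) = 0 then (m - b) * ((ℓ - 1) * (d * e)) + ℓ * d * m + 1
        else (m * (ℓ - 1) + b + (i : ℕ)) * (d * e) + 1) := by
  have hr : 2 ≤ d * e := by nlinarith
  set N : Fin ℓ → ℕ := fun j => if (j : ℕ) = 0 then d * s else 0 with hN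
  have hdet := det_basisDeriv_ne_zero hr m b N
  have hin : ∀ j : Fin ℓ, InDeriv (d * e) (fun _ : Fin ℓ => d * m + 1) (2 * m + 1)
      (basisDeriv (d * e) m (b + (j : ℕ)) (N j)) := by
    refine fun j => basisDeriv_inDeriv hr ?_
    rcases Nat.eq_zero_or_pos (j : ℕ) with hj | hj
    · simp only [hN, hj, if_true, hm]
      exact le_of_eq (by ring)
    · simp only [hN, hj.ne', if_false, hm]
      calc d * (b * e + s) ≤ d * (b * e + e) := by gcongr
        _ = d * e * (b + 1) := by ring
        _ ≤ 0 + d * e * (b + j) := by rw [zero_add]; gcongr; exact hj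
  obtain ⟨k, rfl⟩ : ∃ k, ℓ = k + 1 := ⟨ℓ - 1, by omega⟩
  obtain ⟨q, hq⟩ : ∃ q, m = b + q := ⟨m - b, by
    have : b ≤ b * e := Nat.le_mul_of_pos_right _ (by omega)
    omega⟩
  have hqb : m - b = q := by omega
  have hexp : ∀ j : Fin (k + 1), (k + 1) * N j + (1 + (d * e * (b + (j : ℕ)) +
      (k + 1 - 1) * (m * (d * e)))) = if (j : ℕ) = 0 then
        (m - b) * ((k + 1 - 1) * (d * e)) + (k + 1) * d * m + 1
        else (m * (k + 1 - 1) + b + (j : ℕ)) * (d * e) + 1 := by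
    intro j
    rw [Nat.add_sub_cancel, hqb]
    by_cases hj : (j : ℕ) = 0
    · simp only [hN, hj, if_true]
      have h1 : d * m = d * e * b + d * s := by rw [hm]; ring
      have h2 : (k + 1) * d * m = (k + 1) * (d * e * b + d * s) := by rw [← h1]; ring
      rw [h2, hq]
      ring
    · simp only [hN, hj, if_false]
      ring
  refine ⟨fun j => basisDeriv (d * e) m (b + (j : ℕ)) (N j), hin,
    linearIndependent_of_det_ne_zero hdet, fun η hη => ?_, fun j => ?_⟩
  · refine mem_span_of_linearIndependent (by omega) hin hdet
      (fun j => basisDeriv_isHomogDeriv _ _ _ _) ?_ hη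
    have hcard := two_mul_card_diagIndex (ℓ := k + 1) (r := d * e) (by omega)
    have hNsum : ∑ j : Fin (k + 1), N j = d * s := by
      rw [Fin.sum_univ_succ]
      simp [hN]
    have hid : 2 * ∑ j : Fin (k + 1), (j : ℕ) = (k + 1) * k := by
      rw [Fin.sum_univ_eq_sum_range (fun i => i), mul_comm, Finset.sum_range_id_mul_two,
        Nat.add_sub_cancel]
    rw [Nat.add_sub_cancel] at hcard
    simp only [Nat.add_sub_cancel, Finset.sum_add_distrib, ← Finset.mul_sum, hNsum,
      Finset.sum_const, Finset.card_univ, Fintype.card_fin, smul_eq_mul]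
    have h1 : d * m = d * e * b + d * s := by rw [hm]; ring
    refine Nat.eq_of_mul_eq_mul_left two_pos ?_
    zify at h1 hcard hid ⊢
    linear_combination (d * e : ℤ) * hid - 2 * ((k : ℤ) + 1) * h1 - (2 * (m : ℤ) + 1) * hcard
  · have := basisDeriv_isHomogDeriv (ℓ := k + 1) (d * e) m (b + (j : ℕ)) (N j)
    rwa [hexp j] at this
end
end

section
/- Let r ≥ 2, m ≥ 1, k ≥ 0, and let (A, μ) be the multi-arrangement in ℂ² with defining polynomial Q(A,μ) = x^{kr+1} y^{kr+1} (x^r − y^r)^{2m}. Then (A,μ) is free with both exponents equal to (m+k)r + 1. Moreover, there are homogeneous polynomials q_1, q_2 ∈ ℤ[x,y] of degrees m and m−1 respectively such that (i) all m+1 coefficients of q_1 and all m coefficients of q_2 are nonzero, and (ii) the homogeneous derivations θ_1 := x^{kr+1} q_1(x^r, y^r) ∂_x + y^{kr+1} x^r q_2(x^r, y^r) ∂_y and θ_2 := x^{kr+1} y^r q_2(y^r, x^r) ∂_x + y^{kr+1} q_1(y^r, x^r) ∂_y form an S-basis of D(A,μ). -/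
open MvPolynomial

noncomputable section

theorem exists_int_weights {ι : Type*} [DecidableEq ι] (s : Finset ι) (e : ι → ℕ)
    (he : Set.InjOn e s) :
    ∃ c : ι → ℤ, (∀ i ∈ s, c i ≠ 0) ∧
      ∀ j, j + 1 < s.card → ∑ i ∈ s, c i * ((e i).choose j : ℤ) = 0 := by
  set v : ι → ℚ := fun i => (e i : ℚ) with hv
  have hinj : Set.InjOn v s := fun a ha b hb hab => he ha hb (Nat.cast_injective hab)
  set w : ι → ℚ := fun i => (∏ j ∈ s.erase i, (v i - v j))⁻¹ with hw
  have hw0 : ∀ i ∈ s, w i ≠ 0 := by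
    intro i hi
    refine inv_ne_zero (Finset.prod_ne_zero_iff.mpr fun j hj => sub_ne_zero.mpr fun h => ?_)
    rw [Finset.mem_erase] at hj
    exact hj.1 (hinj hj.2 hi h.symm)
  have hsum : ∀ j, j + 1 < s.card → ∑ i ∈ s, w i * ((e i).choose j : ℚ) = 0 := by
    intro j hj
    have hnd : (descPochhammer ℚ j).natDegree = j := descPochhammer_natDegree ℚ j
    have hdeg : (descPochhammer ℚ j).degree < s.card :=
      lt_of_le_of_lt Polynomial.degree_le_natDegree (by rw [hnd]; exact_mod_cast by omega)
    have h := Lagrange.coeff_eq_sum hinj hdeg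
    rw [Polynomial.coeff_eq_zero_of_natDegree_lt (by omega)] at h
    have hfac : (j.factorial : ℚ) ≠ 0 := by exact_mod_cast j.factorial_ne_zero
    refine (mul_eq_zero.mp ?_).resolve_left hfac
    rw [h, Finset.mul_sum]
    refine Finset.sum_congr rfl fun i _ => ?_
    rw [hv, descPochhammer_eval_eq_descFactorial, Nat.descFactorial_eq_factorial_mul_choose,
      div_eq_mul_inv]
    push_cast
    ring
  obtain ⟨b, hb⟩ := IsLocalization.exist_integer_multiples (nonZeroDivisors ℤ) s w
  have hb0 : ((b : ℤ) : ℚ) ≠ 0 := by exact_mod_cast nonZeroDivisors.coe_ne_zero b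
  have hz : ∀ i ∈ s, ∃ z : ℤ, (z : ℚ) = (b : ℤ) * w i := by
    intro i hi
    obtain ⟨z, hz⟩ := hb i hi
    exact ⟨z, by simpa using hz⟩
  choose! c hc using hz
  refine ⟨c, fun i hi h0 => ?_, fun j hj => ?_⟩
  · have := hc i hi
    rw [h0, Int.cast_zero] at this
    exact mul_ne_zero hb0 (hw0 i hi) this.symm
  · have : ∑ i ∈ s, (c i : ℚ) * ((e i).choose j : ℚ) = 0 := by
      rw [← mul_zero ((b : ℤ) : ℚ), ← hsum j hj, Finset.mul_sum]
      refine Finset.sum_congr rfl fun i hi => ?_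
      rw [hc i hi]
      ring
    exact_mod_cast this

theorem sub_pow_dvd_sum_of_sum_choose_eq_zero {R ι : Type*} [CommRing R] (s : Finset ι)
    (e : ι → ℕ) (c : ι → ℤ) (n N : ℕ) (hN : ∀ i ∈ s, e i ≤ N)
    (hc : ∀ j < n, ∑ i ∈ s, c i * ((e i).choose j : ℤ) = 0) (x y : R) :
    (x - y) ^ n ∣ ∑ i ∈ s, (c i : R) * (x ^ e i * y ^ (N - e i)) := by
  have key : ∀ i ∈ s, x ^ e i * y ^ (N - e i) =
      ∑ j ∈ Finset.range (N + 1), (x - y) ^ j * y ^ (N - j) * ((e i).choose j : R) := by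
    intro i hi
    have hiN := hN i hi
    have hx : x ^ e i = ((x - y) + y) ^ e i := by ring
    rw [hx, add_pow, Finset.sum_mul]
    refine Finset.sum_subset_zero_on_sdiff (Finset.range_mono (by omega)) ?_ ?_
    · intro j hj
      simp only [Finset.mem_sdiff, Finset.mem_range] at hj
      rw [Nat.choose_eq_zero_of_lt (by omega)]
      simp
    · intro j hj
      rw [Finset.mem_range] at hj
      rw [show N - j = (e i - j) + (N - e i) by omega, pow_add]
      ring
  rw [Finset.sum_congr rfl fun i hi => by rw [key i hi, Finset.mul_sum], Finset.sum_comm]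
  refine Finset.dvd_sum fun j _ => ?_
  rcases lt_or_ge j n with hj | hj
  · have h : ∑ i ∈ s, (c i : R) * ((x - y) ^ j * y ^ (N - j) * ((e i).choose j : R)) =
        (x - y) ^ j * y ^ (N - j) * ((∑ i ∈ s, c i * ((e i).choose j : ℤ) : ℤ) : R) := by
      push_cast
      rw [Finset.mul_sum]
      exact Finset.sum_congr rfl fun i _ => by ring
    rw [h, hc j hj]
    simp
  · exact Finset.dvd_sum fun i _ =>
      (((pow_dvd_pow _ hj).mul_right _).mul_right _).mul_left _

/-- The binary form `∑ i ≤ n, c i * X₀ ^ i * X₁ ^ (n - i)`. -/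
def binaryForm (n : ℕ) (c : ℕ → ℤ) : MvPolynomial (Fin 2) ℤ :=
  ∑ i ∈ Finset.range (n + 1), monomial (Finsupp.single 0 i + Finsupp.single 1 (n - i)) (c i)

theorem isHomogeneous_binaryForm (n : ℕ) (c : ℕ → ℤ) : (binaryForm n c).IsHomogeneous n := by
  refine IsHomogeneous.sum _ _ _ fun i hi => isHomogeneous_monomial _ ?_
  rw [Finset.mem_range] at hi
  rw [map_add, Finsupp.degree_single, Finsupp.degree_single]
  omega

theorem coeff_binaryForm {n i : ℕ} (hi : i ≤ n) (c : ℕ → ℤ) :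
    coeff (Finsupp.single 0 i + Finsupp.single 1 (n - i)) (binaryForm n c) = c i := by
  classical
  rw [binaryForm, coeff_sum, Finset.sum_eq_single i]
  · simp
  · intro j _ hji
    rw [coeff_monomial, if_neg]
    intro h
    exact hji (by simpa using DFunLike.congr_fun h 0)
  · intro h
    exact absurd (Finset.mem_range.mpr (by omega)) h

theorem aeval_binaryForm {R : Type*} [CommRing R] [Algebra ℤ R] (n : ℕ) (c : ℕ → ℤ) (u v : R) :
    aeval ![u, v] (binaryForm n c) =
      ∑ i ∈ Finset.range (n + 1), (c i : R) * (u ^ i * v ^ (n - i)) := by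
  rw [binaryForm, map_sum]
  refine Finset.sum_congr rfl fun i _ => ?_
  rw [aeval_monomial, Finsupp.prod_add_index' (by simp) (by simp [pow_add])]
  simp

theorem aeval_binaryForm_one_zero {R : Type*} [CommRing R] [Algebra ℤ R] (n : ℕ) (c : ℕ → ℤ) :
    aeval ![(1 : R), 0] (binaryForm n c) = c n := by
  rw [aeval_binaryForm, Finset.sum_range_succ, Finset.sum_eq_zero]
  · simp
  · intro i hi
    rw [Finset.mem_range] at hi
    rw [zero_pow (by omega)]
    simp

theorem aeval_binaryForm_zero_one {R : Type*} [CommRing R] [Algebra ℤ R] (n : ℕ) (c : ℕ → ℤ) :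
    aeval ![(0 : R), 1] (binaryForm n c) = c 0 := by
  rw [aeval_binaryForm, Finset.sum_range_succ', Finset.sum_eq_zero]
  · simp
  · simp

theorem exists_pade_coefficients (r n k : ℕ) (hr : 2 ≤ r) :
    ∃ a b : ℕ → ℤ, (∀ i ≤ n + 1, a i ≠ 0) ∧ (∀ i ≤ n, b i ≠ 0) ∧
      ∀ (R : Type) [CommRing R] [Algebra ℤ R] (x y z : R), z ^ r = 1 →
        (x - z * y) ^ (2 * (n + 1)) ∣
          x ^ (k * r + 1) * aeval ![x ^ r, y ^ r] (binaryForm (n + 1) a) -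
            z * (y ^ (k * r + 1) * x ^ r * aeval ![x ^ r, y ^ r] (binaryForm n b)) := by
  set e : ℕ ⊕ ℕ → ℕ := Sum.elim (fun i => r * (k + i) + 1) (fun j => r * (j + 1)) with he
  set s : Finset (ℕ ⊕ ℕ) := (Finset.range (n + 1 + 1)).disjSum (Finset.range (n + 1)) with hs
  have hmod : ∀ i j, r * i + 1 ≠ r * j := by
    intro i j h
    have h1 : (r * i + 1) % r = 1 := by
      rw [Nat.mul_add_mod, Nat.mod_eq_of_lt (by omega)]
    rw [h, Nat.mul_mod_right] at h1
    omega
  have hinj : Function.Injective e := by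
    rintro (i | i) (j | j) h
    · have : r * (k + i) = r * (k + j) := by simpa [he] using h
      have := Nat.eq_of_mul_eq_mul_left (by omega) this
      rw [show i = j by omega]
    · exact absurd h (hmod _ _)
    · exact absurd h.symm (hmod _ _)
    · have : r * (i + 1) = r * (j + 1) := h
      have := Nat.eq_of_mul_eq_mul_left (by omega) this
      rw [show i = j by omega]
  have hcard : s.card = 2 * (n + 1) + 1 := by
    rw [hs, Finset.card_disjSum, Finset.card_range, Finset.card_range]
    ring
  obtain ⟨c, hc0, hc⟩ := exists_int_weights s e hinj.injOn
  refine ⟨fun i => c (Sum.inl i), fun i => -c (Sum.inr i), fun i hi => hc0 _ ?_,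
    fun i hi => neg_ne_zero.mpr (hc0 _ ?_), ?_⟩
  · rw [hs, Finset.inl_mem_disjSum, Finset.mem_range]
    omega
  · rw [hs, Finset.inr_mem_disjSum, Finset.mem_range]
    omega
  intro R _ _ x y z hz
  have hzr : ∀ t, z ^ (r * t) = 1 := fun t => by rw [pow_mul, hz, one_pow]
  have hN : ∀ i ∈ s, e i ≤ r * (k + n + 1) + 1 := by
    rintro (i | i) hi
    · rw [hs, Finset.inl_mem_disjSum, Finset.mem_range] at hi
      exact Nat.add_le_add_right (Nat.mul_le_mul_left r (by omega)) 1
    · rw [hs, Finset.inr_mem_disjSum, Finset.mem_range] at hi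
      exact (Nat.mul_le_mul_left r (by omega : i + 1 ≤ k + n + 1)).trans (Nat.le_succ _)
  have h := sub_pow_dvd_sum_of_sum_choose_eq_zero s e c (2 * (n + 1)) _ hN
    (fun j hj => hc j (by omega)) x (z * y)
  convert h using 1
  rw [hs, Finset.sum_disjSum, sub_eq_add_neg, aeval_binaryForm, aeval_binaryForm,
    Finset.mul_sum, Finset.mul_sum, Finset.mul_sum, ← Finset.sum_neg_distrib]
  congr 1
  · refine Finset.sum_congr rfl fun i hi => ?_
    rw [Finset.mem_range] at hi
    have h1 : r * (k + n + 1) + 1 - e (Sum.inl i) = r * (n + 1 - i) := by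
      obtain ⟨t, ht⟩ : ∃ t, n + 1 = i + t := ⟨n + 1 - i, by omega⟩
      simp only [he, Sum.elim_inl]
      rw [show k + n + 1 = k + i + t by omega, ht, Nat.add_sub_cancel_left, mul_add r (k + i) t]
      omega
    rw [h1, mul_pow, hzr, ← pow_mul, ← pow_mul]
    simp only [he, Sum.elim_inl]
    ring
  · refine Finset.sum_congr rfl fun i hi => ?_
    rw [Finset.mem_range] at hi
    have h1 : r * (k + n + 1) + 1 - e (Sum.inr i) = r * (k + (n - i)) + 1 := by
      obtain ⟨t, ht⟩ : ∃ t, n = i + t := ⟨n - i, by omega⟩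
      simp only [he, Sum.elim_inr]
      rw [show k + n + 1 = (i + 1) + (k + t) by omega, ht, Nat.add_sub_cancel_left,
        mul_add r (i + 1)]
      omega
    rw [h1, mul_pow, pow_succ z, hzr, ← pow_mul, ← pow_mul]
    simp only [he, Sum.elim_inr]
    push_cast
    ring

theorem inDeriv_fin_two_iff {r a b n : ℕ} {θ : Derivation ℂ (PolyS 2) (PolyS 2)} :
    InDeriv r ![a, b] n θ ↔ X 0 ^ a ∣ θ (X 0) ∧ X 1 ^ b ∣ θ (X 1) ∧
      ∀ ζ : ℂ, ζ ^ r = 1 → (X 0 - C ζ * X 1) ^ n ∣ θ (X 0) - C ζ * θ (X 1) := by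
  have hC : ∀ (ζ : ℂ) (i j : Fin 2), θ (X i - C ζ * X j) = θ (X i) - C ζ * θ (X j) := by
    intro ζ i j
    rw [map_sub, ← smul_eq_C_mul, θ.map_smul, smul_eq_C_mul]
  simp only [InDeriv, Ideal.mem_span_singleton, Fin.forall_fin_two, hC]
  simp [and_assoc]

/-- The defining polynomial of the multi-arrangement. -/
def arrangementPoly (r a n : ℕ) : PolyS 2 :=
  X 0 ^ a * X 1 ^ a * ∏ ζ ∈ Polynomial.nthRootsFinset r (1 : ℂ), (X 0 - C ζ * X 1) ^ n

theorem isRelPrime_X_zero_X_one : IsRelPrime (X 0 : PolyS 2) (X 1) := by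
  refine (X_prime.irreducible.isRelPrime_iff_not_dvd).mpr ?_
  rw [X_dvd_X]
  simp

theorem isRelPrime_X_one_linear (ζ : ℂ) : IsRelPrime (X 1 : PolyS 2) (X 0 - C ζ * X 1) := by
  intro d h1 h2
  exact isRelPrime_X_zero_X_one ((dvd_sub_left (h1.mul_left _)).mp h2) h1

theorem isRelPrime_linear {ζ ζ' : ℂ} (h : ζ ≠ ζ') :
    IsRelPrime (X 0 - C ζ * X 1 : PolyS 2) (X 0 - C ζ' * X 1) := by
  intro d h1 h2
  have h3 : d ∣ C (ζ' - ζ)⁻¹ * ((X 0 - C ζ * X 1) - (X 0 - C ζ' * X 1)) :=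
    (dvd_sub h1 h2).mul_left _
  have h4 : C (ζ' - ζ)⁻¹ * ((X 0 - C ζ * X 1) - (X 0 - C ζ' * X 1)) = (X 1 : PolyS 2) := by
    have : (C (ζ' - ζ)⁻¹ * C (ζ' - ζ) : PolyS 2) = 1 := by
      rw [← C_mul, inv_mul_cancel₀ (sub_ne_zero.mpr h.symm), C_1]
    rw [C_sub] at this
    linear_combination (X 1 : PolyS 2) * this
  rw [h4] at h3
  exact isRelPrime_X_one_linear ζ h3 h1

theorem isRelPrime_X_zero_linear {ζ : ℂ} (h : ζ ≠ 0) :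
    IsRelPrime (X 0 : PolyS 2) (X 0 - C ζ * X 1) := by
  simpa using isRelPrime_linear h.symm

theorem arrangementPoly_dvd {r a n : ℕ} (hr : 0 < r) {p : PolyS 2} (h0 : X 0 ^ a ∣ p)
    (h1 : X 1 ^ a ∣ p) (h : ∀ ζ : ℂ, ζ ^ r = 1 → (X 0 - C ζ * X 1) ^ n ∣ p) :
    arrangementPoly r a n ∣ p := by
  refine IsRelPrime.mul_dvd (.mul_left (.prod_right ?_) (.prod_right ?_))
    (isRelPrime_X_zero_X_one.pow.mul_dvd h0 h1)
    (Finset.prod_dvd_of_isRelPrime (fun _ _ _ _ hne => (isRelPrime_linear hne).pow) ?_)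
  · exact fun ζ hζ =>
      (isRelPrime_X_zero_linear (Polynomial.ne_zero_of_mem_nthRootsFinset one_ne_zero hζ)).pow
  · exact fun ζ _ => (isRelPrime_X_one_linear ζ).pow
  · exact fun ζ hζ => h ζ ((Polynomial.mem_nthRootsFinset hr 1).mp hζ)

theorem isHomogeneous_arrangementPoly {r : ℕ} (hr : r ≠ 0) (a n : ℕ) :
    (arrangementPoly r a n).IsHomogeneous (2 * a + r * n) := by
  have hlin : ∀ ζ : ℂ, ((X 0 - C ζ * X 1 : PolyS 2) ^ n).IsHomogeneous n := by
    intro ζ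
    simpa using ((isHomogeneous_X ℂ (0 : Fin 2)).sub (isHomogeneous_C_mul_X ζ 1)).pow n
  have hprod := IsHomogeneous.prod (Polynomial.nthRootsFinset r (1 : ℂ)) _ _
    fun ζ _ => hlin ζ
  rw [Finset.sum_const, (Complex.isPrimitiveRoot_exp r hr).card_nthRootsFinset,
    smul_eq_mul] at hprod
  rw [two_mul]
  exact ((isHomogeneous_X_pow 0 a).mul (isHomogeneous_X_pow 1 a)).mul hprod

/-- The determinant of the coefficient matrix of two derivations. -/
def coeffDet (θ η : Derivation ℂ (PolyS 2) (PolyS 2)) : PolyS 2 :=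
  θ (X 0) * η (X 1) - η (X 0) * θ (X 1)

theorem arrangementPoly_dvd_coeffDet {r a n : ℕ} (hr : 0 < r)
    {θ η : Derivation ℂ (PolyS 2) (PolyS 2)} (hθ : InDeriv r ![a, a] n θ)
    (hη : InDeriv r ![a, a] n η) : arrangementPoly r a n ∣ coeffDet θ η := by
  rw [inDeriv_fin_two_iff] at hθ hη
  refine arrangementPoly_dvd hr (dvd_sub (hθ.1.mul_right _) (hη.1.mul_right _))
    (dvd_sub (hη.2.1.mul_left _) (hθ.2.1.mul_left _)) fun ζ hζ => ?_
  have h := dvd_sub ((hθ.2.2 ζ hζ).mul_right (η (X 1))) ((hη.2.2 ζ hζ).mul_right (θ (X 1)))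
  convert h using 1
  rw [coeffDet]
  ring

theorem linearIndependent_of_coeffDet_ne_zero {θ η : Derivation ℂ (PolyS 2) (PolyS 2)}
    (h : coeffDet θ η ≠ 0) : LinearIndependent (PolyS 2) ![θ, η] := by
  rw [LinearIndependent.pair_iff]
  intro a b hab
  have h0 := DFunLike.congr_fun hab (X 0)
  have h1 := DFunLike.congr_fun hab (X 1)
  simp only [Derivation.add_apply, Derivation.smul_apply, smul_eq_mul, Derivation.zero_apply]
    at h0 h1
  constructor
  · refine (mul_eq_zero.mp ?_).resolve_right h
    rw [coeffDet]
    linear_combination η (X 1) * h0 - η (X 0) * h1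
  · refine (mul_eq_zero.mp ?_).resolve_right h
    rw [coeffDet]
    linear_combination θ (X 0) * h1 - θ (X 1) * h0

/-- Saito's criterion: independent elements of the derivation module whose degrees add up to the
degree of the defining polynomial generate the module. -/
theorem mem_span_pair_of_inDeriv {r a n d : ℕ} (hr : 0 < r)
    {θ₁ θ₂ η : Derivation ℂ (PolyS 2) (PolyS 2)} (h₁ : InDeriv r ![a, a] n θ₁)
    (h₂ : InDeriv r ![a, a] n θ₂) (hd₁ : IsHomogDeriv θ₁ d) (hd₂ : IsHomogDeriv θ₂ d)
    (hd : d + d = 2 * a + r * n) (hdet : coeffDet θ₁ θ₂ ≠ 0) (hη : InDeriv r ![a, a] n η) :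
    η ∈ Submodule.span (PolyS 2) {θ₁, θ₂} := by
  obtain ⟨q, hq⟩ := arrangementPoly_dvd_coeffDet hr h₁ h₂
  have hQ0 : arrangementPoly r a n ≠ 0 := fun h => hdet (by rw [hq, h, zero_mul])
  have hq0 : q ≠ 0 := fun h => hdet (by rw [hq, h, mul_zero])
  have hdegdet : (coeffDet θ₁ θ₂).totalDegree = d + d :=
    (((hd₁ 0).mul (hd₂ 1)).sub ((hd₂ 0).mul (hd₁ 1))).totalDegree hdet
  have hdegQ := (isHomogeneous_arrangementPoly hr.ne' a n).totalDegree hQ0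
  have hdeg := totalDegree_mul_of_isDomain hQ0 hq0
  rw [← hq, hdegdet, hdegQ] at hdeg
  obtain ⟨c, rfl⟩ : ∃ c : ℂ, q = C c := ⟨_, totalDegree_eq_zero_iff_eq_C.mp (by omega)⟩
  have hc : (C c : PolyS 2) * C c⁻¹ = 1 := by
    rw [← C_mul, mul_inv_cancel₀ (by rintro rfl; exact hq0 C_0), C_1]
  obtain ⟨u, hu⟩ := arrangementPoly_dvd_coeffDet hr hη h₂
  obtain ⟨v, hv⟩ := arrangementPoly_dvd_coeffDet hr h₁ hη
  rw [Submodule.mem_span_pair]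
  refine ⟨C c⁻¹ * u, C c⁻¹ * v, derivation_ext fun i => mul_left_cancel₀ hQ0 ?_⟩
  simp only [Derivation.add_apply, Derivation.smul_apply, smul_eq_mul]
  rw [coeffDet] at hq hu hv
  revert i
  rw [Fin.forall_fin_two]
  constructor
  · linear_combination -C c⁻¹ * θ₁ (X 0) * hu - C c⁻¹ * θ₂ (X 0) * hv
      + C c⁻¹ * η (X 0) * hq + arrangementPoly r a n * η (X 0) * hc
  · linear_combination -C c⁻¹ * θ₁ (X 1) * hu - C c⁻¹ * θ₂ (X 1) * hv
      + C c⁻¹ * η (X 1) * hq + arrangementPoly r a n * η (X 1) * hc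

theorem stmt7 (r m k : ℕ) (hr : 2 ≤ r) (hm : 1 ≤ m) :
    IsFreeWithExponents (InDeriv r ![k * r + 1, k * r + 1] (2 * m))
      ![(m + k) * r + 1, (m + k) * r + 1] ∧
    ∃ q1 q2 : MvPolynomial (Fin 2) ℤ,
      -- `q1` is homogeneous of degree `m` and all of its `m + 1` coefficients are nonzero
      q1.IsHomogeneous m ∧
      (∀ i ≤ m, MvPolynomial.coeff
        (Finsupp.single (0 : Fin 2) i + Finsupp.single (1 : Fin 2) (m - i)) q1 ≠ 0) ∧
      -- `q2` is homogeneous of degree `m - 1` and all of its `m` coefficients are nonzero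
      q2.IsHomogeneous (m - 1) ∧
      (∀ i ≤ m - 1, MvPolynomial.coeff
        (Finsupp.single (0 : Fin 2) i + Finsupp.single (1 : Fin 2) (m - 1 - i)) q2 ≠ 0) ∧
      -- `θ1 = x^{kr+1} q1(x^r, y^r) ∂_x + y^{kr+1} x^r q2(x^r, y^r) ∂_y` and
      -- `θ2 = x^{kr+1} y^r q2(y^r, x^r) ∂_x + y^{kr+1} q1(y^r, x^r) ∂_y`
      -- form a basis of `D(A, μ)`:
      (fun θ1 θ2 : Derivation ℂ (PolyS 2) (PolyS 2) =>
          InDeriv r ![k * r + 1, k * r + 1] (2 * m) θ1 ∧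
          InDeriv r ![k * r + 1, k * r + 1] (2 * m) θ2 ∧
          LinearIndependent (PolyS 2) ![θ1, θ2] ∧
          ∀ η, InDeriv r ![k * r + 1, k * r + 1] (2 * m) η →
            η ∈ Submodule.span (PolyS 2) {θ1, θ2})
        (MvPolynomial.mkDerivation ℂ
          ![X 0 ^ (k * r + 1) * MvPolynomial.aeval ![(X 0 : PolyS 2) ^ r, X 1 ^ r] q1,
            X 1 ^ (k * r + 1) * X 0 ^ r * MvPolynomial.aeval ![(X 0 : PolyS 2) ^ r, X 1 ^ r] q2])
        (MvPolynomial.mkDerivation ℂ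
          ![X 0 ^ (k * r + 1) * X 1 ^ r * MvPolynomial.aeval ![(X 1 : PolyS 2) ^ r, X 0 ^ r] q2,
            X 1 ^ (k * r + 1) * MvPolynomial.aeval ![(X 1 : PolyS 2) ^ r, X 0 ^ r] q1]) := by
  obtain ⟨n, rfl⟩ : ∃ n, m = n + 1 := ⟨m - 1, by omega⟩
  obtain ⟨a, b, ha, hb, hab⟩ := exists_pade_coefficients r n k hr
  rw [Nat.add_sub_cancel]
  set p := binaryForm (n + 1) a with hp
  set q := binaryForm n b with hq
  have hpow : ∀ i j : Fin 2, ∀ l, (![(X i : PolyS 2) ^ r, X j ^ r] l).IsHomogeneous r := by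
    intro i j l
    fin_cases l
    · exact isHomogeneous_X_pow i r
    · exact isHomogeneous_X_pow j r
  have hph := fun i j => (isHomogeneous_binaryForm (n + 1) a).aeval _ (hpow i j)
  have hqh := fun i j => (isHomogeneous_binaryForm n b).aeval _ (hpow i j)
  set θ₁ : Derivation ℂ (PolyS 2) (PolyS 2) := mkDerivation ℂ
    ![X 0 ^ (k * r + 1) * aeval ![(X 0 : PolyS 2) ^ r, X 1 ^ r] p,
      X 1 ^ (k * r + 1) * X 0 ^ r * aeval ![(X 0 : PolyS 2) ^ r, X 1 ^ r] q]
  set θ₂ : Derivation ℂ (PolyS 2) (PolyS 2) := mkDerivation ℂ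
    ![X 0 ^ (k * r + 1) * X 1 ^ r * aeval ![(X 1 : PolyS 2) ^ r, X 0 ^ r] q,
      X 1 ^ (k * r + 1) * aeval ![(X 1 : PolyS 2) ^ r, X 0 ^ r] p]
  have e₁₀ : θ₁ (X 0) = X 0 ^ (k * r + 1) * aeval ![(X 0 : PolyS 2) ^ r, X 1 ^ r] p :=
    mkDerivation_X ..
  have e₁₁ : θ₁ (X 1) = X 1 ^ (k * r + 1) * X 0 ^ r *
      aeval ![(X 0 : PolyS 2) ^ r, X 1 ^ r] q := mkDerivation_X ..
  have e₂₀ : θ₂ (X 0) = X 0 ^ (k * r + 1) * X 1 ^ r *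
      aeval ![(X 1 : PolyS 2) ^ r, X 0 ^ r] q := mkDerivation_X ..
  have e₂₁ : θ₂ (X 1) = X 1 ^ (k * r + 1) * aeval ![(X 1 : PolyS 2) ^ r, X 0 ^ r] p :=
    mkDerivation_X ..
  have hd₁ : IsHomogDeriv θ₁ ((n + 1 + k) * r + 1) := by
    rw [IsHomogDeriv, Fin.forall_fin_two, e₁₀, e₁₁]
    constructor
    · convert (isHomogeneous_X_pow 0 (k * r + 1)).mul (hph 0 1) using 1
      ring
    · convert ((isHomogeneous_X_pow 1 (k * r + 1)).mul (isHomogeneous_X_pow 0 r)).mul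
        (hqh 0 1) using 1
      ring
  have hd₂ : IsHomogDeriv θ₂ ((n + 1 + k) * r + 1) := by
    rw [IsHomogDeriv, Fin.forall_fin_two, e₂₀, e₂₁]
    constructor
    · convert ((isHomogeneous_X_pow 0 (k * r + 1)).mul (isHomogeneous_X_pow 1 r)).mul
        (hqh 1 0) using 1
      ring
    · convert (isHomogeneous_X_pow 1 (k * r + 1)).mul (hph 1 0) using 1
      ring
  have h₁ : InDeriv r ![k * r + 1, k * r + 1] (2 * (n + 1)) θ₁ := by
    rw [inDeriv_fin_two_iff, e₁₀, e₁₁]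
    exact ⟨dvd_mul_right _ _, (dvd_mul_right _ _).mul_right _,
      fun ζ hζ => hab _ _ _ _ (by rw [← C_pow, hζ, C_1])⟩
  have h₂ : InDeriv r ![k * r + 1, k * r + 1] (2 * (n + 1)) θ₂ := by
    rw [inDeriv_fin_two_iff, e₂₀, e₂₁]
    refine ⟨(dvd_mul_right _ _).mul_right _, dvd_mul_right _ _, fun ζ hζ => ?_⟩
    have hζ0 : ζ ≠ 0 := by
      rintro rfl
      rw [zero_pow (by omega)] at hζ
      exact zero_ne_one hζ
    have hinv : (C ζ : PolyS 2) * C ζ⁻¹ = 1 := by rw [← C_mul, mul_inv_cancel₀ hζ0, C_1]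
    have h := hab (PolyS 2) (X 1) (X 0) (C ζ⁻¹) (by rw [← C_pow, inv_pow, hζ, inv_one, C_1])
    have hlin : (X 0 - C ζ * X 1 : PolyS 2) = -C ζ * (X 1 - C ζ⁻¹ * X 0) := by
      linear_combination (-X 0 : PolyS 2) * hinv
    have hunit : IsUnit ((-C ζ : PolyS 2) ^ (2 * (n + 1))) :=
      ((IsUnit.of_mul_eq_one _ hinv).neg).pow _
    rw [hlin, mul_pow, hunit.mul_left_dvd]
    convert h.mul_left (-C ζ) using 1
    linear_combination (-(X 0 ^ (k * r + 1) * X 1 ^ r *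
      aeval ![(X 1 : PolyS 2) ^ r, X 0 ^ r] q)) * hinv
  have hdet : coeffDet θ₁ θ₂ ≠ 0 := by
    have hfac : coeffDet θ₁ θ₂ = X 0 ^ (k * r + 1) * X 1 ^ (k * r + 1) *
        (aeval ![(X 0 : PolyS 2) ^ r, X 1 ^ r] p * aeval ![(X 1 : PolyS 2) ^ r, X 0 ^ r] p -
          X 0 ^ r * X 1 ^ r * aeval ![(X 0 : PolyS 2) ^ r, X 1 ^ r] q *
            aeval ![(X 1 : PolyS 2) ^ r, X 0 ^ r] q) := by
      rw [coeffDet, e₁₀, e₁₁, e₂₀, e₂₁]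
      ring
    rw [hfac]
    refine mul_ne_zero (mul_ne_zero (pow_ne_zero _ (X_ne_zero 0))
      (pow_ne_zero _ (X_ne_zero 1))) fun h0 => ?_
    have hev : ∀ i j : Fin 2, ∀ f : MvPolynomial (Fin 2) ℤ,
        eval ![(1 : ℂ), 0] (aeval ![(X i : PolyS 2) ^ r, X j ^ r] f) =
          aeval ![![(1 : ℂ), 0] i ^ r, ![(1 : ℂ), 0] j ^ r] f := by
      intro i j f
      rw [← coe_aeval_eq_eval, RingHom.coe_coe, ← AlgHom.restrictScalars_apply ℤ,
        ← AlgHom.comp_apply]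
      congr 1
      refine algHom_ext fun l => ?_
      fin_cases l <;> simp
    have h := congrArg (eval ![(1 : ℂ), 0]) h0
    have hr0 : r ≠ 0 := by omega
    simp only [map_sub, map_mul, hev, map_pow, eval_X, map_zero] at h
    simp only [Matrix.cons_val_zero, Matrix.cons_val_one, one_pow, zero_pow hr0, mul_zero,
      zero_mul, sub_zero, hp, aeval_binaryForm_one_zero, aeval_binaryForm_zero_one] at h
    rcases mul_eq_zero.mp h with h | h
    · exact ha (n + 1) le_rfl (by exact_mod_cast h)
    · exact ha 0 (by omega) (by exact_mod_cast h)
  have hspan := fun η => mem_span_pair_of_inDeriv (η := η) (by omega) h₁ h₂ hd₁ hd₂ (by ring) hdet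
  have hli := linearIndependent_of_coeffDet_ne_zero hdet
  refine ⟨⟨![θ₁, θ₂], ?_, hli, ?_, ?_⟩, p, q, isHomogeneous_binaryForm _ _, fun i hi => ?_,
    isHomogeneous_binaryForm _ _, fun i hi => ?_, h₁, h₂, hli, hspan⟩
  · exact Fin.forall_fin_two.mpr ⟨h₁, h₂⟩
  · rwa [Matrix.range_cons_cons_empty]
  · exact Fin.forall_fin_two.mpr ⟨hd₁, hd₂⟩
  · rw [hp, coeff_binaryForm hi]
    exact ha i hi
  · rw [hq, coeff_binaryForm hi]
    exact hb i hi
end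
end
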